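/- arXiv:1606.05616 — 2 statements merged into one kernel-verified Lean document; each statement's English description precedes it below -/
import Mathlib

section
/- Let n be a natural number divisible by 3, and let G₁ and G₂ be simple graphs on a common vertex set V of size n, each with more than (5/9)·(n choose 2) edges. Let C₁ be a connected component of G₁ with the largest number of vertices and C₂ a connected component of G₂ with the largest number of vertices. Then there is a pair of vertices {x, y} that is simultaneously an edge of G₁ inside C₁ and an edge of G₂ inside C₂. -/
open Finset in
/-- The ordered pairs of adjacent vertices number twice the edges. -/
lemma card_filter_adj_eq_two_mul_ncard_edgeSet {V : Type*} [Fintype V] [DecidableEq V]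
    (G : SimpleGraph V) [DecidableRel G.Adj] :
    #{p : V × V | G.Adj p.1 p.2} = 2 * G.edgeSet.ncard := by
  rw [← SimpleGraph.coe_edgeFinset, Set.ncard_coe_finset,
    ← SimpleGraph.sum_degrees_eq_twice_card_edges, card_filter, Fintype.sum_prod_type]
  refine sum_congr rfl fun x _ ↦ ?_
  rw [← card_filter, ← SimpleGraph.card_neighborFinset_eq_degree,
    SimpleGraph.neighborFinset_eq_filter]

open Finset in
/-- If every component has at most `a` vertices, then every degree is at most `a - 1`. -/
lemma two_mul_ncard_edgeSet_add_card_le {V : Type*} [Fintype V] (G : SimpleGraph V) {a : ℕ}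
    (ha : ∀ c : G.ConnectedComponent, c.supp.ncard ≤ a) :
    2 * G.edgeSet.ncard + Fintype.card V ≤ Fintype.card V * a := by
  classical
  have hdeg (v : V) : G.degree v + 1 ≤ a := by
    refine le_trans ?_ (ha (G.connectedComponentMk v))
    rw [← SimpleGraph.card_neighborFinset_eq_degree,
      ← card_insert_of_notMem (G.notMem_neighborFinset_self v), ← Set.ncard_coe_finset]
    refine Set.ncard_le_ncard (fun w hw ↦ ?_) (Set.toFinite _)
    rw [SimpleGraph.ConnectedComponent.mem_supp_iff, SimpleGraph.ConnectedComponent.eq]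
    rcases mem_insert.1 (mem_coe.1 hw) with rfl | hw
    · rfl
    · exact ((G.mem_neighborFinset _ _).1 hw).symm.reachable
  have hsum := sum_le_sum fun v (_ : v ∈ univ) ↦ hdeg v
  rw [sum_add_distrib, SimpleGraph.sum_degrees_eq_twice_card_edges] at hsum
  rw [← SimpleGraph.coe_edgeFinset, Set.ncard_coe_finset]
  simpa using hsum

open Finset in
/-- All edges outside a component `A` lie within the complement of `A`. -/
lemma two_mul_ncard_edgeSet_le_card_inter_offDiag_add {V : Type*} [Fintype V] [DecidableEq V]
    (G : SimpleGraph V) [DecidableRel G.Adj] (c : G.ConnectedComponent) (A : Finset V)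
    (hA : ∀ x, x ∈ A ↔ x ∈ c.supp) :
    2 * G.edgeSet.ncard ≤
      #(({p : V × V | G.Adj p.1 p.2} : Finset (V × V)) ∩ A.offDiag) + #Aᶜ.offDiag := by
  rw [← card_filter_adj_eq_two_mul_ncard_edgeSet]
  refine le_trans (card_le_card fun p hp ↦ ?_) (card_union_le _ _)
  have hadj : G.Adj p.1 p.2 := by simpa using hp
  have hiff := c.mem_supp_congr_adj hadj
  simp only [mem_union, mem_inter, mem_offDiag, mem_compl, hA]
  have := hadj.ne
  tauto

lemma int_cast_card_offDiag {V : Type*} [DecidableEq V] (s : Finset V) :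
    (s.offDiag.card : ℤ) = s.card * (s.card - 1) := by
  rw [Finset.offDiag_card, Nat.cast_sub (Nat.le_mul_self _)]
  push_cast
  ring

/-- A graph on `3 * m` vertices with edge density above `5 / 9` has a component with more than
`2 * m` vertices; here `E` is twice the number of edges and `a` the size of that component. -/
lemma two_mul_lt_of_density {m a E : ℤ} (hm : 0 < m) (hE : 5 * m * (3 * m - 1) < 3 * E)
    (hdeg : E + 3 * m ≤ 3 * m * a)
    (hsplit : E ≤ a * (a - 1) + (3 * m - a) * (3 * m - a - 1)) : 2 * m < a := by
  by_contra! h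
  have h1 : 5 * (3 * m - 1) < 9 * (a - 1) := by
    refine lt_of_mul_lt_mul_left (a := m) ?_ hm.le
    linarith
  nlinarith [mul_nonneg (sub_nonneg.2 h) (show 0 ≤ a - m by linarith)]

/-- The edge count which forces two dense graphs to share an edge in their largest components. -/
lemma offDiag_count_lt {m a b i E₁ E₂ : ℤ} (ha : 2 * m < a) (ha' : a ≤ 3 * m)
    (hb : 2 * m < b) (hb' : b ≤ 3 * m) (hi : a + b - 3 * m ≤ i)
    (hE₁ : 5 * m * (3 * m - 1) < 3 * E₁) (hE₂ : 5 * m * (3 * m - 1) < 3 * E₂) :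
    a * (a - 1) + b * (b - 1) - i * (i - 1) <
      E₁ - (3 * m - a) * (3 * m - a - 1) + (E₂ - (3 * m - b) * (3 * m - b - 1)) := by
  have hmono : (a + b - 3 * m) * (a + b - 3 * m - 1) ≤ i * (i - 1) := by
    nlinarith [mul_nonneg (sub_nonneg.2 hi) (show 0 ≤ i + (a + b - 3 * m) - 1 by linarith)]
  have hd : (a - b) ^ 2 ≤ (m - 1) ^ 2 := by
    apply sq_le_sq' <;> linarith
  nlinarith

/-- **Lemma (graphmeet (iv)).** If `3 ∣ n` and `G₁, G₂` are graphs on a common vertex set of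
size `n`, each with more than `(5/9)·(n choose 2)` edges, and `C₁`, `C₂` are connected
components of `G₁`, `G₂` respectively with the largest number of vertices, then there is a
pair of vertices which is simultaneously an edge of `G₁` inside `C₁` and an edge of `G₂`
inside `C₂`. -/
theorem largest_components_share_edge {V : Type} [Fintype V] (n : ℕ)
    (hn : Fintype.card V = n) (h3 : 3 ∣ n) (G₁ G₂ : SimpleGraph V)
    (he₁ : (5 : ℝ) / 9 * (n.choose 2) < (G₁.edgeSet.ncard : ℝ))
    (he₂ : (5 : ℝ) / 9 * (n.choose 2) < (G₂.edgeSet.ncard : ℝ))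
    (c₁ : G₁.ConnectedComponent)
    (hc₁ : ∀ c' : G₁.ConnectedComponent, c'.supp.ncard ≤ c₁.supp.ncard)
    (c₂ : G₂.ConnectedComponent)
    (hc₂ : ∀ c' : G₂.ConnectedComponent, c'.supp.ncard ≤ c₂.supp.ncard) :
    ∃ x y : V, G₁.Adj x y ∧ G₂.Adj x y ∧
      x ∈ c₁.supp ∧ y ∈ c₁.supp ∧ x ∈ c₂.supp ∧ y ∈ c₂.supp := by
  classical
  obtain ⟨m, rfl⟩ := h3
  have hm : (0 : ℤ) < m := by
    have : Nonempty V := c₁.nonempty_supp.to_type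
    have := Fintype.card_pos (α := V)
    omega
  have hdense {G : SimpleGraph V}
      (he : (5 : ℝ) / 9 * ((3 * m).choose 2) < (G.edgeSet.ncard : ℝ)) :
      5 * (m : ℤ) * (3 * m - 1) < 3 * (2 * G.edgeSet.ncard) := by
    rw [Nat.cast_choose_two] at he
    push_cast at he
    have : 5 * (m : ℝ) * (3 * m - 1) < 3 * (2 * G.edgeSet.ncard) := by linarith
    exact_mod_cast this
  have hcompl (A : Finset V) : ((Aᶜ).card : ℤ) = 3 * m - A.card := by
    have := A.card_add_card_compl
    omega
  have hlarge {G : SimpleGraph V} {c : G.ConnectedComponent}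
      (hc : ∀ c' : G.ConnectedComponent, c'.supp.ncard ≤ c.supp.ncard)
      (he : (5 : ℝ) / 9 * ((3 * m).choose 2) < (G.edgeSet.ncard : ℝ)) :
      2 * (m : ℤ) < c.supp.toFinset.card ∧ (c.supp.toFinset.card : ℤ) ≤ 3 * m := by
    have hdeg := two_mul_ncard_edgeSet_add_card_le G hc
    rw [hn, Set.ncard_eq_toFinset_card' c.supp] at hdeg
    have hsplit := two_mul_ncard_edgeSet_le_card_inter_offDiag_add G c c.supp.toFinset (by simp)
    have hsplit' := hsplit.trans (Nat.add_le_add_right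
      (Finset.card_le_card Finset.inter_subset_right) _)
    zify at hdeg hsplit'
    rw [int_cast_card_offDiag, int_cast_card_offDiag, hcompl] at hsplit'
    refine ⟨two_mul_lt_of_density hm (hdense he) (by linarith) hsplit', ?_⟩
    have := c.supp.toFinset.card_le_univ
    omega
  obtain ⟨ha, ha'⟩ := hlarge hc₁ he₁
  obtain ⟨hb, hb'⟩ := hlarge hc₂ he₂
  have hs₁ := two_mul_ncard_edgeSet_le_card_inter_offDiag_add G₁ c₁ c₁.supp.toFinset (by simp)
  have hs₂ := two_mul_ncard_edgeSet_le_card_inter_offDiag_add G₂ c₂ c₂.supp.toFinset (by simp)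
  set A := c₁.supp.toFinset with hA
  set B := c₂.supp.toFinset with hB
  set P := ({p : V × V | G₁.Adj p.1 p.2} : Finset (V × V)) ∩ A.offDiag with hP
  set Q := ({p : V × V | G₂.Adj p.1 p.2} : Finset (V × V)) ∩ B.offDiag with hQ
  have hPQ : ¬ Disjoint P Q := by
    intro hdisj
    have hcard := Finset.card_le_card (Finset.union_subset_union
      (Finset.inter_subset_right : P ⊆ A.offDiag) (Finset.inter_subset_right : Q ⊆ B.offDiag))
    rw [Finset.card_union_of_disjoint hdisj] at hcard
    have hoff := Finset.card_union_add_card_inter A.offDiag B.offDiag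
    rw [← Finset.offDiag_inter] at hoff
    have hi := Finset.card_union_add_card_inter A B
    have hu := (A ∪ B).card_le_univ
    zify at hs₁ hs₂ hcard hoff
    simp only [int_cast_card_offDiag, hcompl] at hs₁ hs₂ hoff
    have := offDiag_count_lt (i := (A ∩ B).card) ha ha' hb hb' (by omega)
      (hdense he₁) (hdense he₂)
    linarith
  obtain ⟨p, hp, hq⟩ := Finset.not_disjoint_iff.1 hPQ
  simp only [hP, hQ, hA, hB, Finset.mem_inter, Finset.mem_filter, Finset.mem_univ, true_and,
    Finset.mem_offDiag, Set.mem_toFinset] at hp hq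
  exact ⟨p.1, p.2, hp.1, hq.1, hp.2.1, hp.2.2.1, hq.2.1, hq.2.2.1⟩
end

section
/- Let n be a natural number divisible by 3 and let H be a 3-uniform hypergraph on n vertices with minimum vertex degree δ(H) > (5/9)·(n choose 2). Then H admits a tightly-connected perfect fractional matching; that is, there is an assignment of weights w_e ∈ [0,1] to the edges e of H such that for every vertex v the sum of w_e over edges e containing v is at most 1, the total weight ∑_e w_e equals n/3, and all edges with nonzero weight lie in a single tight component of H. -/
/-- There is a tight walk in the hypergraph with edge set `E` from the edge `e` to the
edge `e'`: a sequence of (not necessarily distinct) edges starting at `e` and ending at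
`e'` in which consecutive edges intersect in exactly two vertices. -/
def HasTightWalk {V : Type} [DecidableEq V] (E : Finset (Finset V))
    (e e' : Finset V) : Prop :=
  ∃ (ℓ : ℕ) (f : ℕ → Finset V), f 0 = e ∧ f ℓ = e' ∧ (∀ i ≤ ℓ, f i ∈ E) ∧
    ∀ i < ℓ, (f i ∩ f (i + 1)).card = 2

theorem HasTightWalk.refl {V : Type} [DecidableEq V] {E : Finset (Finset V)} {e : Finset V}
    (he : e ∈ E) : HasTightWalk E e e :=
  ⟨0, fun _ => e, rfl, rfl, fun _ _ => he, fun _ hi => absurd hi (Nat.not_lt_zero _)⟩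

theorem HasTightWalk.symm {V : Type} [DecidableEq V] {E : Finset (Finset V)} {e e' : Finset V}
    (h : HasTightWalk E e e') : HasTightWalk E e' e := by
  obtain ⟨l, f, h0, hl, hE, hf⟩ := h
  refine ⟨l, fun i => f (l - i), by simpa using hl, by simpa using h0,
    fun i _ => hE _ (Nat.sub_le _ _), fun i hi => ?_⟩
  have h1 := hf (l - (i + 1)) (by omega)
  rw [show l - (i + 1) + 1 = l - i by omega] at h1
  rwa [Finset.inter_comm]

theorem HasTightWalk.trans {V : Type} [DecidableEq V] {E : Finset (Finset V)}
    {e e' e'' : Finset V} (h : HasTightWalk E e e') (h' : HasTightWalk E e' e'') :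
    HasTightWalk E e e'' := by
  obtain ⟨l, f, h0, hl, hE, hf⟩ := h
  obtain ⟨m, g, g0, gm, gE, hg⟩ := h'
  refine ⟨l + m, fun i => if i ≤ l then f i else g (i - l), by simpa using h0, ?_, ?_, ?_⟩
  · rcases Nat.eq_zero_or_pos m with rfl | hm
    · simp [hl, ← g0, gm]
    · simp [hm.ne', gm]
  · intro i hi
    dsimp only
    split_ifs with h
    · exact hE i h
    · exact gE _ (by omega)
  · intro i hi
    dsimp only
    rcases lt_trichotomy i l with h | rfl | h
    · rw [if_pos h.le, if_pos (by omega)]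
      exact hf i h
    · rw [if_pos le_rfl, if_neg (by omega), hl, ← g0]
      simpa using hg 0 (by omega)
    · rw [if_neg (by omega), if_neg (by omega), show i + 1 - l = i - l + 1 by omega]
      exact hg _ (by omega)

theorem HasTightWalk.of_two_le_card_inter {V : Type} [DecidableEq V] {E : Finset (Finset V)}
    (hE : ∀ e ∈ E, e.card = 3) {e e' : Finset V} (he : e ∈ E) (he' : e' ∈ E)
    (h : 2 ≤ (e ∩ e').card) : HasTightWalk E e e' := by
  have hle : (e ∩ e').card ≤ 3 := hE e he ▸ Finset.card_le_card Finset.inter_subset_left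
  obtain h2 | h3 : (e ∩ e').card = 2 ∨ (e ∩ e').card = 3 := by omega
  · refine ⟨1, fun i => if i = 0 then e else e', by simp, by simp, fun i _ => ?_, fun i hi => ?_⟩
    · dsimp only
      split_ifs <;> assumption
    · obtain rfl : i = 0 := by omega
      simpa using h2
  · have h1 : e ∩ e' = e := Finset.eq_of_subset_of_card_le Finset.inter_subset_left
      (by rw [h3, hE e he])
    have h1' : e ∩ e' = e' := Finset.eq_of_subset_of_card_le Finset.inter_subset_right
      (by rw [h3, hE e' he'])
    rw [← h1.symm.trans h1']
    exact .refl he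

open Classical in
/-- The tight component of the edge `e` in the hypergraph with edge set `E`. -/
noncomputable def tightComponent {V : Type} [DecidableEq V] (E : Finset (Finset V))
    (e : Finset V) : Finset (Finset V) :=
  E.filter fun e' => HasTightWalk E e e'

theorem mem_tightComponent {V : Type} [DecidableEq V] {E : Finset (Finset V)}
    {e e' : Finset V} : e' ∈ tightComponent E e ↔ e' ∈ E ∧ HasTightWalk E e e' := by
  simp [tightComponent]

theorem tightComponent_subset {V : Type} [DecidableEq V] (E : Finset (Finset V))
    (e : Finset V) : tightComponent E e ⊆ E :=
  fun _ h => (mem_tightComponent.1 h).1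

theorem mem_tightComponent_of_two_le_card_inter {V : Type} [DecidableEq V]
    {E : Finset (Finset V)} (hE : ∀ e ∈ E, e.card = 3) {e f f' : Finset V}
    (hf : f ∈ tightComponent E e) (hf' : f' ∈ E) (h : 2 ≤ (f ∩ f').card) :
    f' ∈ tightComponent E e := by
  rw [mem_tightComponent] at hf ⊢
  exact ⟨hf', hf.2.trans (.of_two_le_card_inter hE hf.1 hf' h)⟩

/-- The vertices other than `v` that share an edge of `C` with `v`. -/
def linkVertices {V : Type} [Fintype V] [DecidableEq V] (C : Finset (Finset V)) (v : V) :
    Finset V :=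
  Finset.univ.filter fun x => x ≠ v ∧ ∃ e ∈ C, v ∈ e ∧ x ∈ e

theorem mem_linkVertices {V : Type} [Fintype V] [DecidableEq V] {C : Finset (Finset V)}
    {v x : V} : x ∈ linkVertices C v ↔ x ≠ v ∧ ∃ e ∈ C, v ∈ e ∧ x ∈ e := by
  simp [linkVertices]

theorem erase_subset_linkVertices {V : Type} [Fintype V] [DecidableEq V]
    {C : Finset (Finset V)} {v : V} {e : Finset V} (he : e ∈ C) (hv : v ∈ e) :
    e.erase v ⊆ linkVertices C v := fun _ hx =>
  mem_linkVertices.2 ⟨Finset.ne_of_mem_erase hx, e, he, hv, Finset.mem_of_mem_erase hx⟩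

theorem card_linkVertices_lt {V : Type} [Fintype V] [DecidableEq V]
    (C : Finset (Finset V)) (v : V) : (linkVertices C v).card < Fintype.card V :=
  Finset.card_lt_univ_of_notMem (x := v) (by simp [mem_linkVertices])

theorem card_image_erase {V : Type} [DecidableEq V] {F : Finset (Finset V)} {v : V}
    (hF : ∀ e ∈ F, v ∈ e) : (F.image fun e => e.erase v).card = F.card := by
  refine Finset.card_image_of_injOn fun e he e' he' h => ?_
  rw [← Finset.insert_erase (hF e he), h, Finset.insert_erase (hF e' he')]

theorem card_le_choose_two_of_erase_subset {V : Type} [DecidableEq V]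
    {F : Finset (Finset V)} {v : V} {A : Finset V} (hv : ∀ e ∈ F, v ∈ e)
    (h3 : ∀ e ∈ F, e.card = 3) (hA : ∀ e ∈ F, e.erase v ⊆ A) :
    F.card ≤ A.card.choose 2 := by
  rw [← card_image_erase hv, ← Finset.card_powersetCard]
  refine Finset.card_le_card fun p hp => ?_
  obtain ⟨e, he, rfl⟩ := Finset.mem_image.1 hp
  rw [Finset.mem_powersetCard, Finset.card_erase_of_mem (hv e he), h3 e he]
  exact ⟨hA e he, rfl⟩

theorem degree_le_degree_tightComponent_add {V : Type} [Fintype V] [DecidableEq V]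
    {E : Finset (Finset V)} (hE : ∀ e ∈ E, e.card = 3) (a : Finset V) (v : V) :
    (E.filter fun e => v ∈ e).card ≤ ((tightComponent E a).filter fun e => v ∈ e).card +
      (Fintype.card V - 1 - (linkVertices (tightComponent E a) v).card).choose 2 := by
  set C := tightComponent E a with hC
  have hsplit : E.filter (fun e => v ∈ e) ⊆
      C.filter (fun e => v ∈ e) ∪ (E \ C).filter (fun e => v ∈ e) := by
    intro e he
    by_cases h : e ∈ C <;> simp_all
  refine (Finset.card_le_card hsplit).trans ((Finset.card_union_le _ _).trans ?_)
  gcongr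
  have hcard : ((Finset.univ.erase v) \ linkVertices C v).card =
      Fintype.card V - 1 - (linkVertices C v).card := by
    rw [Finset.card_sdiff_of_subset, Finset.card_erase_of_mem (Finset.mem_univ v),
      Finset.card_univ]
    exact fun x hx => Finset.mem_erase.2 ⟨(mem_linkVertices.1 hx).1, Finset.mem_univ x⟩
  rw [← hcard]
  refine card_le_choose_two_of_erase_subset (v := v) (fun e he => (Finset.mem_filter.1 he).2)
    (fun e he => hE e ?_) fun e he x hx => ?_
  · exact (Finset.mem_sdiff.1 (Finset.mem_filter.1 he).1).1
  · obtain ⟨he, hve⟩ := Finset.mem_filter.1 he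
    obtain ⟨heE, heC⟩ := Finset.mem_sdiff.1 he
    obtain ⟨hxv, hxe⟩ := Finset.mem_erase.1 hx
    refine Finset.mem_sdiff.2 ⟨Finset.mem_erase.2 ⟨hxv, Finset.mem_univ x⟩, fun hl => heC ?_⟩
    obtain ⟨-, f, hf, hvf, hxf⟩ := mem_linkVertices.1 hl
    refine mem_tightComponent_of_two_le_card_inter hE hf heE ?_
    rw [← Finset.card_pair hxv]
    refine Finset.card_le_card fun z hz => ?_
    rcases Finset.mem_insert.1 hz with rfl | hz
    · exact Finset.mem_inter.2 ⟨hxf, hxe⟩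
    · rw [Finset.mem_singleton.1 hz]
      exact Finset.mem_inter.2 ⟨hvf, hve⟩

theorem degree_le_choose_linkVertices {V : Type} [Fintype V] [DecidableEq V]
    {C : Finset (Finset V)} (hC : ∀ e ∈ C, e.card = 3) (v : V) :
    (C.filter fun e => v ∈ e).card ≤ (linkVertices C v).card.choose 2 :=
  card_le_choose_two_of_erase_subset (v := v) (fun _ he => (Finset.mem_filter.1 he).2)
    (fun e he => hC e (Finset.mem_filter.1 he).1) fun _ he =>
      erase_subset_linkVertices (Finset.mem_filter.1 he).1 (Finset.mem_filter.1 he).2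

/-- Double counting the edges at `v`: some vertex `x` has codegree with `v` at least the
average. -/
theorem exists_two_mul_degree_le_codegree {V : Type} [Fintype V] [DecidableEq V]
    {E : Finset (Finset V)} (hE : ∀ e ∈ E, e.card = 3) (v : V) (hV : 1 < Fintype.card V) :
    ∃ x, x ≠ v ∧ 2 * (E.filter fun e => v ∈ e).card ≤
      (Fintype.card V - 1) * ((E.filter fun e => v ∈ e).filter fun e => x ∈ e).card := by
  set F := E.filter fun e => v ∈ e with hF
  have hsum : ∑ x ∈ Finset.univ.erase v, (F.filter fun e => x ∈ e).card = 2 * F.card := by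
    have h := Finset.sum_card_bipartiteAbove_eq_sum_card_bipartiteBelow
      (s := Finset.univ.erase v) (t := F) (fun x e => x ∈ e)
    unfold Finset.bipartiteAbove Finset.bipartiteBelow at h
    rw [h, Finset.sum_const_nat (m := 2), mul_comm]
    intro e he
    have hfe : (Finset.univ.erase v).filter (fun x => x ∈ e) = e.erase v := by
      ext x
      simp
    rw [hfe, Finset.card_erase_of_mem (Finset.mem_filter.1 he).2,
      hE e (Finset.mem_filter.1 he).1]
  have hc : (Finset.univ.erase v).card = Fintype.card V - 1 := by
    rw [Finset.card_erase_of_mem (Finset.mem_univ v), Finset.card_univ]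
  have hne : (Finset.univ.erase v).Nonempty := Finset.card_pos.1 (by omega)
  obtain ⟨x, hx, hmax⟩ := Finset.exists_max_image (Finset.univ.erase v)
    (fun x => (F.filter fun e => x ∈ e).card) hne
  refine ⟨x, Finset.ne_of_mem_erase hx, ?_⟩
  rw [← hsum, ← hc, ← smul_eq_mul]
  exact Finset.sum_le_card_nsmul _ _ _ hmax

theorem exists_large_tightComponent {V : Type} [Fintype V] [DecidableEq V] {k : ℕ}
    (hV : Fintype.card V = 3 * k) {E : Finset (Finset V)} (hE : ∀ e ∈ E, e.card = 3) (v : V)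
    (hδ : (5 : ℝ) / 9 * ((3 * k).choose 2) < ((E.filter fun e => v ∈ e).card : ℝ)) :
    ∃ a ∈ E, 2 * k ≤ (linkVertices (tightComponent E a) v).card := by
  have hk : 0 < k := by
    have := Fintype.card_pos_iff.2 ⟨v⟩
    omega
  obtain ⟨x, hxv, hx⟩ := exists_two_mul_degree_le_codegree hE v (by omega)
  set F := (E.filter fun e => v ∈ e).filter fun e => x ∈ e with hF
  have hFpos : 0 < F.card := by
    rw [Nat.pos_iff_ne_zero]
    intro h0
    rw [h0, mul_zero, Nat.le_zero, mul_eq_zero] at hx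
    rcases hx with hx | hx
    · omega
    · rw [hx] at hδ
      have : (0 : ℝ) ≤ 5 / 9 * ((3 * k).choose 2) := by positivity
      simp only [Nat.cast_zero] at hδ
      linarith
  obtain ⟨a, ha⟩ := Finset.card_pos.1 hFpos
  have hmem : ∀ e, e ∈ F ↔ e ∈ E ∧ v ∈ e ∧ x ∈ e := fun e => by
    simp [hF, and_assoc]
  obtain ⟨haE, hva, hxa⟩ := (hmem a).1 ha
  refine ⟨a, haE, ?_⟩
  set N := linkVertices (tightComponent E a) v with hN
  have haC : a ∈ tightComponent E a := mem_tightComponent.2 ⟨haE, .refl haE⟩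
  have hxN : x ∈ N := mem_linkVertices.2 ⟨hxv, a, haC, hva, hxa⟩
  have hFN : F.card ≤ N.card - 1 := by
    rw [← Finset.card_erase_of_mem hxN, ← card_image_erase (v := v) fun e he => ((hmem e).1 he).2.1,
      ← card_image_erase (v := x)]
    · rw [← Finset.card_image_of_injective (N.erase x) Finset.singleton_injective]
      refine Finset.card_le_card fun p hp => ?_
      simp only [Finset.mem_image, exists_exists_and_eq_and] at hp
      obtain ⟨e, he, rfl⟩ := hp
      obtain ⟨heE, hve, hxe⟩ := (hmem e).1 he
      have hxe' : x ∈ e.erase v := Finset.mem_erase.2 ⟨hxv, hxe⟩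
      have hc : ((e.erase v).erase x).card = 1 := by
        rw [Finset.card_erase_of_mem hxe', Finset.card_erase_of_mem hve, hE e heE]
      obtain ⟨z, hz⟩ := Finset.card_eq_one.1 hc
      refine Finset.mem_image.2 ⟨z, ?_, hz.symm⟩
      have hze : z ∈ (e.erase v).erase x := hz ▸ Finset.mem_singleton_self z
      rw [Finset.mem_erase] at hze ⊢
      refine ⟨hze.1, erase_subset_linkVertices ?_ hve hze.2⟩
      refine mem_tightComponent_of_two_le_card_inter hE haC heE ?_
      rw [← Finset.card_pair hxv]
      refine Finset.card_le_card fun y hy => ?_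
      rcases Finset.mem_insert.1 hy with rfl | hy
      · exact Finset.mem_inter.2 ⟨hxa, hxe⟩
      · rw [Finset.mem_singleton.1 hy]
        exact Finset.mem_inter.2 ⟨hva, hve⟩
    · intro p hp
      obtain ⟨e, he, rfl⟩ := Finset.mem_image.1 hp
      exact Finset.mem_erase.2 ⟨hxv, ((hmem e).1 he).2.2⟩
  have hdeg := (degree_le_degree_tightComponent_add hE a v).trans (Nat.add_le_add_right
    (degree_le_choose_linkVertices (fun e he => hE e (tightComponent_subset E a he)) v) _)
  have hNlt : N.card < 3 * k := hV ▸ card_linkVertices_lt _ _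
  have hN1 : 1 ≤ N.card := Finset.card_pos.2 ⟨x, hxN⟩
  rw [← hN] at hdeg
  by_contra! hlt
  obtain ⟨m, hm⟩ : ∃ m, N.card = m := ⟨_, rfl⟩
  obtain ⟨b, hb⟩ : ∃ b, 3 * k - 1 - m = b := ⟨_, rfl⟩
  rw [hm] at hFN hdeg hNlt hN1 hlt
  rw [hV, hb] at hdeg
  have hbm : (b : ℝ) = 3 * k - 1 - m := by
    have : b + 1 + m = 3 * k := by omega
    have : (b : ℝ) + 1 + m = 3 * k := by exact_mod_cast this
    linarith
  have hx' : 2 * (E.filter fun e => v ∈ e).card ≤ (3 * k - 1) * (m - 1) :=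
    hx.trans (by rw [hV]; gcongr)
  have hdegR : ((E.filter fun e => v ∈ e).card : ℝ) ≤ m * (m - 1) / 2 + b * (b - 1) / 2 := by
    rw [← Nat.cast_choose_two, ← Nat.cast_choose_two]
    exact_mod_cast hdeg
  have hxR : 2 * ((E.filter fun e => v ∈ e).card : ℝ) ≤ (3 * k - 1) * (m - 1) := by
    have h := (Nat.cast_le (α := ℝ)).2 hx'
    push_cast [Nat.cast_sub hN1, Nat.cast_sub (show 1 ≤ 3 * k by omega)] at h
    exact h
  rw [Nat.cast_choose_two] at hδ
  push_cast at hδ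
  have hkR : (1 : ℝ) ≤ k := by exact_mod_cast hk
  have hltR : (m : ℝ) + 1 ≤ 2 * k := by exact_mod_cast hlt
  have hmlow : (5 : ℝ) / 3 * k < m - 1 := by
    by_contra! h
    nlinarith
  rw [hbm] at hdegR
  nlinarith [mul_nonneg (sub_nonneg.2 hltR) (sub_nonneg.2 hmlow.le)]

/-- If the minimum vertex degree exceeds `(5/9)·(n choose 2)`, then two tight components whose
links at `u` and `v` respectively have at least `2n/3` non-isolated vertices coincide. -/
theorem tightComponent_eq_of_large {V : Type} [Fintype V] [DecidableEq V] {k : ℕ}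
    (hV : Fintype.card V = 3 * k) {E : Finset (Finset V)} (hE : ∀ e ∈ E, e.card = 3)
    (hδ : ∀ v : V, (5 : ℝ) / 9 * ((3 * k).choose 2) < ((E.filter fun e => v ∈ e).card : ℝ))
    {a b : Finset V} {u v : V}
    (hu : 2 * k ≤ (linkVertices (tightComponent E a) u).card)
    (hv : 2 * k ≤ (linkVertices (tightComponent E b) v).card) :
    tightComponent E a = tightComponent E b := by
  set A := linkVertices (tightComponent E a) u with hA
  set B := linkVertices (tightComponent E b) v with hB
  set P := ((tightComponent E a).filter fun e => u ∈ e).image fun e => e.erase u with hP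
  set Q := ((tightComponent E b).filter fun e => v ∈ e).image fun e => e.erase v with hQ
  have hshare : ¬ Disjoint P Q := by
    intro hdisj
    have hsub : P ∪ Q ⊆ A.powersetCard 2 ∪ B.powersetCard 2 := by
      refine Finset.union_subset_union (fun p hp => ?_) fun p hp => ?_
      · obtain ⟨e, he, rfl⟩ := Finset.mem_image.1 hp
        obtain ⟨he, hue⟩ := Finset.mem_filter.1 he
        rw [Finset.mem_powersetCard, Finset.card_erase_of_mem hue,
          hE e (tightComponent_subset E a he)]
        exact ⟨erase_subset_linkVertices he hue, rfl⟩
      · obtain ⟨e, he, rfl⟩ := Finset.mem_image.1 hp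
        obtain ⟨he, hue⟩ := Finset.mem_filter.1 he
        rw [Finset.mem_powersetCard, Finset.card_erase_of_mem hue,
          hE e (tightComponent_subset E b he)]
        exact ⟨erase_subset_linkVertices he hue, rfl⟩
    have hinter : (A ∩ B).powersetCard 2 ⊆ A.powersetCard 2 ∩ B.powersetCard 2 := by
      intro p hp
      simp only [Finset.mem_inter, Finset.mem_powersetCard, Finset.subset_inter_iff] at hp ⊢
      tauto
    have h1 := Finset.card_le_card hsub
    have h2 := Finset.card_le_card hinter
    have h3 := Finset.card_union_add_card_inter (A.powersetCard 2) (B.powersetCard 2)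
    rw [Finset.card_union_of_disjoint hdisj, card_image_erase fun e he => (Finset.mem_filter.1 he).2,
      card_image_erase fun e he => (Finset.mem_filter.1 he).2] at h1
    simp only [Finset.card_powersetCard] at h2 h3
    have h4 := degree_le_degree_tightComponent_add hE a u
    have h5 := degree_le_degree_tightComponent_add hE b v
    rw [← hA] at h4
    rw [← hB] at h5
    have h6 := Finset.card_union_add_card_inter A B
    have h7 : (A ∪ B).card ≤ 3 * k := hV ▸ Finset.card_le_univ _
    have h8 : A.card < 3 * k := hV ▸ card_linkVertices_lt _ _
    have h9 : B.card < 3 * k := hV ▸ card_linkVertices_lt _ _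
    obtain ⟨p, hp⟩ : ∃ p, 3 * k - 1 - A.card = p := ⟨_, rfl⟩
    obtain ⟨q, hq⟩ : ∃ q, 3 * k - 1 - B.card = q := ⟨_, rfl⟩
    rw [hV, hp] at h4
    rw [hV, hq] at h5
    have hk : p + q + 2 ≤ 2 * k := by omega
    have hr : 3 * k ≤ (A ∩ B).card + p + q + 2 := by omega
    obtain ⟨r, hr'⟩ : ∃ r, 3 * k = r + p + q + 2 := ⟨3 * k - p - q - 2, by omega⟩
    have h10 : r.choose 2 ≤ (A ∩ B).card.choose 2 := Nat.choose_le_choose 2 (by omega)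
    have hAc : A.card = r + q + 1 := by omega
    have hBc : B.card = r + p + 1 := by omega
    have hpk : p + 1 ≤ k := by omega
    have hqk : q + 1 ≤ k := by omega
    rw [hAc, hBc] at h3
    have hmain : (E.filter fun e => u ∈ e).card + (E.filter fun e => v ∈ e).card + r.choose 2 ≤
        (r + q + 1).choose 2 + (r + p + 1).choose 2 + p.choose 2 + q.choose 2 := by omega
    have hmainR := (Nat.cast_le (α := ℝ)).2 hmain
    have hu' := hδ u
    have hv' := hδ v
    have hrR : (3 : ℝ) * k = r + p + q + 2 := by exact_mod_cast hr'
    have hpR : (p : ℝ) + 1 ≤ k := by exact_mod_cast hpk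
    have hqR : (q : ℝ) + 1 ≤ k := by exact_mod_cast hqk
    have hp0 : (0 : ℝ) ≤ p := by positivity
    have hq0 : (0 : ℝ) ≤ q := by positivity
    push_cast [Nat.cast_choose_two] at hmainR hu' hv'
    have hr_eq : (r : ℝ) = 3 * k - p - q - 2 := by linarith
    rw [hr_eq] at hmainR
    nlinarith [mul_nonneg hp0 (sub_nonneg.2 hpR), mul_nonneg hq0 (sub_nonneg.2 hqR),
      mul_nonneg hp0 hq0]
  obtain ⟨p, hpP, hpQ⟩ := Finset.not_disjoint_iff.1 hshare
  obtain ⟨e, he, rfl⟩ := Finset.mem_image.1 hpP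
  obtain ⟨f, hf, hef⟩ := Finset.mem_image.1 hpQ
  obtain ⟨he, hue⟩ := Finset.mem_filter.1 he
  obtain ⟨hf, hvf⟩ := Finset.mem_filter.1 hf
  have hcard : 2 ≤ (e ∩ f).card := by
    have : (e.erase u).card = 2 := by
      rw [Finset.card_erase_of_mem hue, hE e (tightComponent_subset E a he)]
    rw [← this]
    exact Finset.card_le_card (Finset.subset_inter (Finset.erase_subset _ _)
      (hef ▸ Finset.erase_subset _ _))
  rw [mem_tightComponent] at he hf
  have hab : HasTightWalk E a b :=
    (he.2.trans (.of_two_le_card_inter hE he.1 hf.1 hcard)).trans hf.2.symm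
  ext g
  simp only [mem_tightComponent]
  exact and_congr_right fun _ => ⟨hab.symm.trans, hab.trans⟩

/-- Every finite set can be enumerated so that a given function is decreasing along the
enumeration. -/
theorem Finset.exists_antitone_enumeration {V : Type} (A : Finset V) (y : V → ℝ) :
    ∃ g : Fin A.card → V, Function.Injective g ∧ (∀ x, x ∈ A ↔ ∃ i, g i = x) ∧
      Antitone (y ∘ g) := by
  let h : Fin A.card → V := fun i => (A.equivFin.symm i : V)
  let σ := Tuple.sort fun i => -y (h i)
  have hmono := Tuple.monotone_sort fun i => -y (h i)
  refine ⟨fun i => h (σ i), ?_, ?_, ?_⟩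
  · exact (Subtype.val_injective.comp A.equivFin.symm.injective).comp σ.injective
  · intro x
    constructor
    · intro hx
      exact ⟨σ.symm (A.equivFin ⟨x, hx⟩), by simp [h]⟩
    · rintro ⟨i, rfl⟩
      exact (A.equivFin.symm (σ i)).2
  · intro i j hij
    exact neg_le_neg_iff.1 (hmono hij)

/-- A fractional form of the Erdős–Gallai bound: if a graph on `A` admits a fractional vertex
cover of weight less than `k`, then its number of edges is bounded as for graphs without a
matching of size `k`. -/
theorem card_le_of_fractional_cover {V : Type} [DecidableEq V] {A : Finset V} {k : ℕ}
    (hk : 2 * k ≤ A.card) {y : V → ℝ} (hy : ∀ x, 0 ≤ y x) {t : ℝ}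
    (hsum : ∑ x ∈ A, y x < t * k) {F : Finset (Finset V)}
    (hF : ∀ p ∈ F, p ∈ A.powersetCard 2) (hcov : ∀ p ∈ F, t ≤ ∑ x ∈ p, y x) :
    ∃ j < k, F.card ≤ (2 * k - 1 - j).choose 2 + j * (A.card - (2 * k - 1 - j)) := by
  obtain ⟨g, hg, hgA, hanti⟩ := A.exists_antitone_enumeration y
  let lo : Fin k → Fin A.card := fun j => ⟨j, by omega⟩
  let hi : Fin k → Fin A.card := fun j => ⟨2 * k - 1 - j, by omega⟩
  obtain ⟨j, hj⟩ : ∃ j : Fin k, y (g (lo j)) + y (g (hi j)) < t := by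
    by_contra! hcon
    have h1 : ∑ _j : Fin k, t ≤ ∑ j : Fin k, (y (g (lo j)) + y (g (hi j))) :=
      Finset.sum_le_sum fun j _ => hcon j
    have hlo : Function.Injective fun j => g (lo j) := fun i j hij => by
      simpa [lo, Fin.ext_iff] using hg hij
    have hhi : Function.Injective fun j => g (hi j) := fun i j hij => by
      have := hg hij
      simp only [hi, Fin.mk.injEq] at this
      omega
    have hdisj : Disjoint (Finset.univ.image fun j => g (lo j))
        (Finset.univ.image fun j => g (hi j)) := by
      rw [Finset.disjoint_left]
      intro x hx hx'
      simp only [Finset.mem_image, Finset.mem_univ, true_and] at hx hx'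
      obtain ⟨i, rfl⟩ := hx
      obtain ⟨l, hl⟩ := hx'
      have := hg hl
      simp only [hi, lo, Fin.mk.injEq] at this
      omega
    have hsub : (Finset.univ.image fun j => g (lo j)) ∪
        (Finset.univ.image fun j => g (hi j)) ⊆ A := by
      intro x hx
      simp only [Finset.mem_union, Finset.mem_image, Finset.mem_univ, true_and] at hx
      rw [hgA]
      rcases hx with ⟨i, rfl⟩ | ⟨i, rfl⟩ <;> exact ⟨_, rfl⟩
    have h2 := Finset.sum_le_sum_of_subset_of_nonneg hsub fun x _ _ => hy x
    rw [Finset.sum_union hdisj, Finset.sum_image hlo.injOn, Finset.sum_image hhi.injOn,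
      ← Finset.sum_add_distrib] at h2
    simp only [Finset.sum_const, Finset.card_univ, Fintype.card_fin, nsmul_eq_mul] at h1
    linarith
  refine ⟨j, j.2, ?_⟩
  let P : Finset V := (Finset.Iio (lo j)).image g
  let Q : Finset V := (Finset.Iio (hi j)).image g
  have hP : P.card = j := by
    rw [Finset.card_image_of_injective _ hg, Fin.card_Iio]
  have hQ : Q.card = 2 * k - 1 - j := by
    rw [Finset.card_image_of_injective _ hg, Fin.card_Iio]
  have hQA : Q ⊆ A := fun x hx => by
    obtain ⟨i, -, rfl⟩ := Finset.mem_image.1 hx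
    exact (hgA _).2 ⟨i, rfl⟩
  have hFsub : F ⊆ Q.powersetCard 2 ∪ (P ×ˢ (A \ Q)).image fun z => {z.1, z.2} := by
    intro p hp
    obtain ⟨hpA, hpc⟩ := Finset.mem_powersetCard.1 (hF p hp)
    obtain ⟨x, z, hxz, rfl⟩ := Finset.card_eq_two.1 hpc
    obtain ⟨i, rfl⟩ := (hgA x).1 (hpA (by simp))
    obtain ⟨l, rfl⟩ := (hgA z).1 (hpA (by simp))
    have key : ∀ i l : Fin A.card, i < l → t ≤ y (g i) + y (g l) →
        ({g i, g l} : Finset V) ∈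
          Q.powersetCard 2 ∪ (P ×ˢ (A \ Q)).image fun z => {z.1, z.2} := by
      intro i l hil ht
      by_cases hl : l < hi j
      · refine Finset.mem_union_left _ (Finset.mem_powersetCard.2
          ⟨?_, Finset.card_pair (hg.ne hil.ne)⟩)
        rw [Finset.insert_subset_iff, Finset.singleton_subset_iff]
        exact ⟨Finset.mem_image_of_mem g (by simp [hil.trans hl]),
          Finset.mem_image_of_mem g (by simp [hl])⟩
      · by_cases hi' : i < lo j
        · refine Finset.mem_union_right _ (Finset.mem_image.2 ⟨(g i, g l), ?_, rfl⟩)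
          refine Finset.mem_product.2 ⟨Finset.mem_image_of_mem g (by simp [hi']),
            Finset.mem_sdiff.2 ⟨(hgA _).2 ⟨l, rfl⟩, fun hlQ => hl ?_⟩⟩
          obtain ⟨l', hl', hll⟩ := Finset.mem_image.1 hlQ
          rw [← hg hll]
          exact Finset.mem_Iio.1 hl'
        · have h1 : y (g i) ≤ y (g (lo j)) := hanti (not_lt.1 hi')
          have h2 : y (g l) ≤ y (g (hi j)) := hanti (not_lt.1 hl)
          linarith
    have ht := hcov _ hp
    rw [Finset.sum_pair hxz] at ht
    rcases lt_trichotomy i l with h | rfl | h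
    · exact key i l h ht
    · exact absurd rfl hxz
    · rw [Finset.pair_comm]
      exact key l i h (by linarith)
  refine (Finset.card_le_card hFsub).trans ((Finset.card_union_le _ _).trans ?_)
  rw [Finset.card_powersetCard, hQ]
  gcongr
  refine Finset.card_image_le.trans ?_
  rw [Finset.card_product, hP, Finset.card_sdiff_of_subset hQA, hQ]

/-- Linear programming duality for perfect fractional matchings of `3`-uniform hypergraphs. -/
theorem exists_perfect_fractional_matching_or_dual {V : Type} [Fintype V] [DecidableEq V]
    (C : Finset (Finset V)) (hV : 0 < Fintype.card V) :
    (∃ w : Finset V → ℝ, (∀ e, 0 ≤ w e) ∧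
      (∀ v : V, ∑ e ∈ C.filter (fun e => v ∈ e), w e = 1) ∧
      ∑ e ∈ C, w e = (Fintype.card V : ℝ) / 3) ∨
    ∃ (y : V → ℝ) (s : ℝ), (∀ e ∈ C, s ≤ ∑ x ∈ e, y x) ∧
      ∑ x, y x < s * ((Fintype.card V : ℝ) / 3) := by
  have hn : (0 : ℝ) < (Fintype.card V : ℝ) / 3 := by positivity
  let χ : Finset V → V → ℝ := fun e v => if v ∈ e then 1 else 0
  have hχ : Function.Injective χ := fun e e' h => by
    ext v
    have := congrFun h v
    by_cases h1 : v ∈ e <;> by_cases h2 : v ∈ e' <;> simp_all [χ]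
  by_cases hmem : (fun _ => ((Fintype.card V : ℝ) / 3)⁻¹ : V → ℝ) ∈
      convexHull ℝ (C.image χ : Set (V → ℝ))
  · left
    obtain ⟨w, hw0, hw1, hw⟩ := (Finset.mem_convexHull' (R := ℝ)).1 hmem
    rw [Finset.sum_image hχ.injOn] at hw1 hw
    refine ⟨fun e => if e ∈ C then (Fintype.card V : ℝ) / 3 * w (χ e) else 0, ?_, ?_, ?_⟩
    · intro e
      dsimp only
      split_ifs with he
      · exact mul_nonneg hn.le (hw0 _ (Finset.mem_image_of_mem χ he))
      · exact le_rfl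
    · intro v
      have hv := congrFun hw v
      simp only [Finset.sum_apply, Pi.smul_apply, smul_eq_mul, χ, mul_ite, mul_one, mul_zero,
        ← Finset.sum_filter] at hv
      rw [Finset.sum_congr rfl fun e he => if_pos (Finset.mem_filter.1 he).1, ← Finset.mul_sum,
        hv, mul_inv_cancel₀ hn.ne']
    · rw [Finset.sum_congr rfl fun e he => if_pos he, ← Finset.mul_sum, hw1, mul_one]
  · right
    have hclosed : IsClosed (convexHull ℝ (C.image χ : Set (V → ℝ))) :=
      ((C.image χ).finite_toSet.isCompact_convexHull ℝ).isClosed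
    obtain ⟨f, s, hfs, hs⟩ := geometric_hahn_banach_point_closed (convex_convexHull ℝ _)
      hclosed hmem
    have hf : ∀ z : V → ℝ, f z = ∑ x, z x * f (Pi.single x 1) := fun z => by
      conv_lhs => rw [pi_eq_sum_univ' z]
      simp [map_sum]
    refine ⟨fun x => f (Pi.single x 1), s, fun e he => ?_, ?_⟩
    · have h := hs (χ e) (subset_convexHull ℝ _ (by simpa using ⟨e, he, rfl⟩))
      rw [hf] at h
      simpa [χ, Finset.sum_ite_mem] using h.le
    · rw [hf, ← Finset.mul_sum, inv_mul_lt_iff₀ hn] at hfs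
      linarith

/-- Every vertex weighting that is at least `s` on the edges of a tight component whose links
all have at least `2n/3` non-isolated vertices has average at least `s / 3`. -/
theorem le_sum_of_large_tightComponent {V : Type} [Fintype V] [DecidableEq V] {k : ℕ}
    (hV : Fintype.card V = 3 * k) (hk : 0 < k) {E : Finset (Finset V)}
    (hE : ∀ e ∈ E, e.card = 3)
    (hδ : ∀ v : V, (5 : ℝ) / 9 * ((3 * k).choose 2) < ((E.filter fun e => v ∈ e).card : ℝ))
    {a : Finset V} (ha : ∀ v, 2 * k ≤ (linkVertices (tightComponent E a) v).card)
    {y : V → ℝ} {s : ℝ} (hy : ∀ e ∈ tightComponent E a, s ≤ ∑ x ∈ e, y x) :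
    s * k ≤ ∑ x, y x := by
  by_contra! hlt
  have : Nonempty V := Fintype.card_pos_iff.1 (by omega)
  obtain ⟨v, -, hv⟩ := Finset.exists_min_image Finset.univ y Finset.univ_nonempty
  set C := tightComponent E a with hC
  set A := linkVertices C v with hA
  set F := (C.filter fun e => v ∈ e).image fun e => e.erase v with hF
  have hFA : ∀ p ∈ F, p ∈ A.powersetCard 2 := fun p hp => by
    obtain ⟨e, he, rfl⟩ := Finset.mem_image.1 hp
    obtain ⟨he, hve⟩ := Finset.mem_filter.1 he
    rw [Finset.mem_powersetCard, Finset.card_erase_of_mem hve,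
      hE e (tightComponent_subset E a he)]
    exact ⟨erase_subset_linkVertices he hve, rfl⟩
  have hcov : ∀ p ∈ F, s - 3 * y v ≤ ∑ x ∈ p, (y x - y v) := fun p hp => by
    have hpc := (Finset.mem_powersetCard.1 (hFA p hp)).2
    rw [Finset.sum_sub_distrib, Finset.sum_const, hpc]
    obtain ⟨e, he, rfl⟩ := Finset.mem_image.1 hp
    obtain ⟨he, hve⟩ := Finset.mem_filter.1 he
    have h1 := hy e he
    rw [← Finset.sum_erase_add _ _ hve] at h1
    rw [nsmul_eq_mul]
    push_cast
    linarith
  have hy0 : ∀ x, 0 ≤ y x - y v := fun x => sub_nonneg.2 (hv x (Finset.mem_univ x))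
  have hsum : ∑ x ∈ A, (y x - y v) < (s - 3 * y v) * k := by
    refine (Finset.sum_le_sum_of_subset_of_nonneg (Finset.subset_univ A)
      fun x _ _ => hy0 x).trans_lt ?_
    rw [Finset.sum_sub_distrib, Finset.sum_const, Finset.card_univ, hV, nsmul_eq_mul]
    push_cast
    linarith
  obtain ⟨j, hjk, hj⟩ := card_le_of_fractional_cover (ha v) hy0 hsum hFA hcov
  rw [card_image_erase fun e he => (Finset.mem_filter.1 he).2] at hj
  have hdeg := (degree_le_degree_tightComponent_add hE a v).trans (Nat.add_le_add_right hj _)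
  have hAlt : A.card < 3 * k := hV ▸ card_linkVertices_lt _ _
  have hAk := ha v
  rw [← hA] at hdeg hAk
  obtain ⟨b, hb⟩ : ∃ b, 3 * k - 1 - A.card = b := ⟨_, rfl⟩
  obtain ⟨q, hq⟩ : ∃ q, 2 * k - 1 - j = q := ⟨_, rfl⟩
  obtain ⟨r, hr⟩ : ∃ r, A.card - q = r := ⟨_, rfl⟩
  rw [hV, hb, hq, hr] at hdeg
  have hqj : q + 1 + j = 2 * k := by omega
  have hrb : r + b = k + j := by omega
  have hbk : b + 1 ≤ k := by omega
  have hδv := hδ v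
  have hdegR := hδv.trans_le (Nat.cast_le.2 hdeg)
  push_cast [Nat.cast_choose_two] at hdegR
  have hqR : (q : ℝ) = 2 * k - 1 - j := by
    have : (q : ℝ) + 1 + j = 2 * k := by exact_mod_cast hqj
    linarith
  have hrR : (r : ℝ) = k + j - b := by
    have : (r : ℝ) + b = k + j := by exact_mod_cast hrb
    linarith
  have hbR : (b : ℝ) + 1 ≤ k := by exact_mod_cast hbk
  have hjR : (j : ℝ) + 1 ≤ k := by exact_mod_cast hjk
  have hb0 : (0 : ℝ) ≤ b := by positivity
  have hj0 : (0 : ℝ) ≤ j := by positivity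
  rw [hqR, hrR] at hdegR
  nlinarith [mul_nonneg hb0 (sub_nonneg.2 hbR), mul_nonneg hj0 (sub_nonneg.2 hjR),
    mul_nonneg (sub_nonneg.2 hbR) (sub_nonneg.2 hjR), mul_nonneg hb0 hj0]

/-- **Lemma (fracmatch (ii)).** If `3 ∣ n` and `H` is a 3-graph on `n` vertices with minimum
vertex degree greater than `(5/9)·(n choose 2)`, then `H` admits a tightly-connected
perfect fractional matching: edge weights in `[0,1]`, total weight at most `1` at each
vertex, total weight exactly `n/3`, and all edges of nonzero weight in a common tight
component. -/
theorem tightly_connected_perfect_fractional_matching {V : Type} [Fintype V] [DecidableEq V]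
    (n : ℕ) (hn : Fintype.card V = n) (h3 : 3 ∣ n)
    (E : Finset (Finset V)) (hE : ∀ e ∈ E, e.card = 3)
    (hδ : ∀ v : V, (5 : ℝ) / 9 * (n.choose 2) < ((E.filter (fun e => v ∈ e)).card : ℝ)) :
    ∃ w : Finset V → ℝ, (∀ e, 0 ≤ w e ∧ w e ≤ 1) ∧ (∀ e ∉ E, w e = 0) ∧
      (∀ v : V, ∑ e ∈ E.filter (fun e => v ∈ e), w e ≤ 1) ∧
      (∑ e ∈ E, w e = (n : ℝ) / 3) ∧
      (∀ e ∈ E, ∀ e' ∈ E, w e ≠ 0 → w e' ≠ 0 → HasTightWalk E e e') := by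
  classical
  subst hn
  obtain ⟨k, hk⟩ := h3
  rcases Nat.eq_zero_or_pos k with rfl | hkpos
  · have : IsEmpty V := Fintype.card_eq_zero_iff.1 (by omega)
    exact ⟨0, by simp, by simp, fun v => isEmptyElim v, by simp, by simp⟩
  rw [hk] at hδ
  choose c _ hc using fun v => exists_large_tightComponent hk hE v (hδ v)
  have : Nonempty V := Fintype.card_pos_iff.1 (by omega)
  obtain ⟨v₀⟩ := this
  have hlarge : ∀ v, 2 * k ≤ (linkVertices (tightComponent E (c v₀)) v).card := fun v =>
    tightComponent_eq_of_large hk hE hδ (hc v) (hc v₀) ▸ hc v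
  have hn3 : (Fintype.card V : ℝ) / 3 = k := by
    rw [hk]
    push_cast
    ring
  set C := tightComponent E (c v₀) with hC
  have hCE : C ⊆ E := tightComponent_subset E _
  rcases exists_perfect_fractional_matching_or_dual C (by omega) with
    ⟨w, hw0, hwv, hw⟩ | ⟨y, s, hy, hs⟩
  · have hle : ∀ e ∈ C, w e ≤ 1 := fun e he => by
      obtain ⟨v, hv⟩ := Finset.card_pos.1 (show 0 < e.card by rw [hE e (hCE he)]; norm_num)
      rw [← hwv v]
      exact Finset.single_le_sum (fun f _ => hw0 f) (Finset.mem_filter.2 ⟨he, hv⟩)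
    have hmem : ∀ e, (if e ∈ C then w e else 0) ≠ 0 → e ∈ C := fun e h => by
      by_contra he
      exact h (if_neg he)
    refine ⟨fun e => if e ∈ C then w e else 0, fun e => ?_, fun e he => ?_, fun v => ?_, ?_, ?_⟩
    · dsimp only
      split_ifs with he
      · exact ⟨hw0 e, hle e he⟩
      · exact ⟨le_rfl, zero_le_one⟩
    · exact if_neg fun h => he (hCE h)
    · refine le_of_eq ?_
      rw [← hwv v, ← Finset.sum_filter, Finset.filter_filter]
      refine Finset.sum_congr ?_ fun _ _ => rfl
      ext e
      simp only [Finset.mem_filter]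
      exact ⟨fun h => ⟨h.2.2, h.2.1⟩, fun h => ⟨hCE h.1, h.2, h.1⟩⟩
    · rw [← hw, ← Finset.sum_filter, Finset.filter_mem_eq_inter,
        Finset.inter_eq_right.2 hCE]
    · intro e _ e' _ he he'
      exact (mem_tightComponent.1 (hmem e he)).2.symm.trans (mem_tightComponent.1 (hmem e' he')).2
  · rw [hn3] at hs
    exact absurd (le_sum_of_large_tightComponent hk hkpos hE hδ hlarge hy) (not_le.2 hs)
end
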